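/- Suppose 0 < ζ_T < n (T is manipulated in at least one but not all of the n experiments) and every child of T is manipulated in at least one experiment (ch(T) ⊆ ⋃_{i=1}^n Υ_i). Then ⋂_{i=1}^n MB_i(T) ⊆ sp(T): the intersection contains no parent of T that is not also a spouse of T, and no child of T that is not also a spouse of T. (Corrected weak form of part (1) of the paper's Theorem on the intersection when 0 < ζ_T < n.) -/

import Mathlib

/-- Parents of `T`: direct causes. -/
def parents {V : Type*} (E : V → V → Prop) (T : V) : Set V := {X | E X T}

/-- Children of `T`: direct effects. -/
def children {V : Type*} (E : V → V → Prop) (T : V) : Set V := {Y | E T Y}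

/-- Spouses of `T`: other direct causes of children of `T`. -/
def spouses {V : Type*} (E : V → V → Prop) (T : V) : Set V :=
  {X | X ≠ T ∧ ∃ Y, E T Y ∧ E X Y}

/-- Markov blanket of `T`. -/
def markovBlanket {V : Type*} (E : V → V → Prop) (T : V) : Set V :=
  parents E T ∪ children E T ∪ spouses E T

/-- Post-intervention edge relation: edges into manipulated variables are deleted. -/
def postE {V : Type*} (E : V → V → Prop) (Υ : Set V) : V → V → Prop :=
  fun X Y => E X Y ∧ Y ∉ Υ

/-- A DAG: the transitive closure of the edge relation is irreflexive. -/
def Acyclic {V : Type*} (E : V → V → Prop) : Prop :=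
  Irreflexive (Relation.TransGen E)

/-- A family of intervention sets is conservative if every manipulated variable
is unmanipulated in at least one experiment. -/
def Conservative {V ι : Type*} (Υ : ι → Set V) : Prop :=
  ∀ X ∈ ⋃ i, Υ i, ∃ k, X ∉ Υ k

/-- `ζ_T`: the number of experiments in which `T` is manipulated. -/
noncomputable def zeta {V : Type*} {n : ℕ} (Υ : Fin n → Set V) (T : V) : ℕ :=
  Nat.card {i : Fin n // T ∈ Υ i}

/-- 0 < ζ_T < n and every child of T manipulated in at least one
experiment ⟹ ⋂ MB_i(T) ⊆ sp(T). -/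
theorem inter_mb_subset_sp_of_sometimes_manipulated
    {V : Type*} [Fintype V] (E : V → V → Prop) (hacyc : Acyclic E) (T : V)
    {n : ℕ} (Υ : Fin n → Set V)
    (hζpos : 0 < zeta Υ T) (hζlt : zeta Υ T < n)
    (hch : children E T ⊆ ⋃ i, Υ i) :
    (⋂ i, markovBlanket (postE E (Υ i)) T) ⊆ spouses E T := by
  intro X hX
  rw [Set.mem_iInter] at hX
  have mem_spouses {i : Fin n} (h : X ∈ spouses (postE E (Υ i)) T) : X ∈ spouses E T :=
    ⟨h.1, h.2.imp fun _ hY => ⟨hY.1.1, hY.2.1⟩⟩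
  by_cases hTX : E T X
  · obtain ⟨i, hi⟩ := Set.mem_iUnion.mp (hch hTX)
    rcases hX i with (hpa | hchild) | hsp
    · exact (hacyc T (.tail (.single hTX) hpa.1)).elim
    · exact (hchild.2 hi).elim
    · exact mem_spouses hsp
  · obtain ⟨⟨i, hi⟩⟩ := (Nat.card_pos_iff.mp hζpos).1
    rcases hX i with (hpa | hchild) | hsp
    · exact (hpa.2 hi).elim
    · exact (hTX hchild.1).elim
    · exact mem_spouses hsp
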